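/- arXiv:quant-ph/0602056 — 2 statements merged into one kernel-verified Lean document; each statement's English description precedes it below -/
import Mathlib

section
/- The two partial traces of a pure state have equal von Neumann entropy: let A and B be nonempty finite types and ψ : Matrix A B ℝ with ∑ a b, (ψ a b)^2 = 1. Define ρ_A : Matrix A A ℝ by (ρ_A) a a' = ∑ b, ψ a b * ψ a' b, and ρ_B : Matrix B B ℝ by (ρ_B) b b' = ∑ a, ψ a b * ψ a b'. Then ρ_A and ρ_B are symmetric positive semidefinite of trace 1 and S(ρ_A) = S(ρ_B). -/
/-- The von Neumann entropy of a real symmetric matrix. -/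
noncomputable def vnEntropy {n : Type*} [Fintype n] [DecidableEq n]
    {ρ : Matrix n n ℝ} (hρ : ρ.IsHermitian) : ℝ :=
  ∑ i, Real.negMulLog (hρ.eigenvalues i)

/-- The von Neumann entropy is the sum of `Real.negMulLog` over the roots of the characteristic
polynomial, counted with multiplicity. -/
theorem vnEntropy_eq_sum_roots_charpoly {n : Type*} [Fintype n] [DecidableEq n]
    {ρ : Matrix n n ℝ} (hρ : ρ.IsHermitian) :
    vnEntropy hρ = (ρ.charpoly.roots.map Real.negMulLog).sum := by
  rw [hρ.roots_charpoly_eq_eigenvalues, Multiset.map_map]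
  rfl

open Polynomial in
/-- Multiplying a polynomial by a power of `X` only adds zero roots, which do not contribute
to a sum of values of `Real.negMulLog`. -/
theorem sum_map_negMulLog_roots_X_pow_mul {p : ℝ[X]} (hp : p ≠ 0) (k : ℕ) :
    ((X ^ k * p).roots.map Real.negMulLog).sum = (p.roots.map Real.negMulLog).sum := by
  rw [roots_mul (mul_ne_zero (pow_ne_zero k X_ne_zero) hp), roots_X_pow]
  simp [Multiset.map_nsmul, Multiset.sum_nsmul]

/-- The matrix products `M * N` and `N * M` have the same von Neumann entropy. -/
theorem vnEntropy_mul_comm {m n : Type*} [Fintype m] [Fintype n] [DecidableEq m] [DecidableEq n]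
    (M : Matrix m n ℝ) (N : Matrix n m ℝ) (hMN : (M * N).IsHermitian) (hNM : (N * M).IsHermitian) :
    vnEntropy hMN = vnEntropy hNM := by
  rw [vnEntropy_eq_sum_roots_charpoly, vnEntropy_eq_sum_roots_charpoly,
    ← sum_map_negMulLog_roots_X_pow_mul (M * N).charpoly_monic.ne_zero (Fintype.card n),
    Matrix.charpoly_mul_comm',
    sum_map_negMulLog_roots_X_pow_mul (N * M).charpoly_monic.ne_zero]

/-- the two partial traces of a pure state are symmetric positive
semidefinite of trace 1 and have equal von Neumann entropy. -/
theorem partial_traces_equal_entropy {A B : Type*}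
    [Fintype A] [Fintype B] [DecidableEq A] [DecidableEq B] [Nonempty A] [Nonempty B]
    (ψ : Matrix A B ℝ) (hψ : ∑ a, ∑ b, (ψ a b) ^ 2 = 1)
    (ρA : Matrix A A ℝ) (hρA : ∀ a a', ρA a a' = ∑ b, ψ a b * ψ a' b)
    (ρB : Matrix B B ℝ) (hρB : ∀ b b', ρB b b' = ∑ a, ψ a b * ψ a b') :
    ρA.IsHermitian ∧ ρA.PosSemidef ∧ ρA.trace = 1 ∧
    ρB.IsHermitian ∧ ρB.PosSemidef ∧ ρB.trace = 1 ∧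
    ∀ (hA : ρA.IsHermitian) (hB : ρB.IsHermitian), vnEntropy hA = vnEntropy hB := by
  obtain rfl : ρA = ψ * ψ.conjTranspose := by
    ext a a'
    simp [hρA, Matrix.mul_apply]
  obtain rfl : ρB = ψ.conjTranspose * ψ := by
    ext b b'
    simp [hρB, Matrix.mul_apply]
  have htrace : (ψ * ψ.conjTranspose).trace = 1 := by
    rw [← hψ]
    simp [Matrix.trace, Matrix.mul_apply, sq]
  have hA := Matrix.posSemidef_self_mul_conjTranspose ψ
  have hB := Matrix.posSemidef_conjTranspose_mul_self ψ
  exact ⟨hA.isHermitian, hA, htrace, hB.isHermitian, hB,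
    (Matrix.trace_mul_comm _ _).trans htrace, vnEntropy_mul_comm _ _⟩
end

section
/- Infinite-dimensional entropy bound: define σ_{N+1} : ℤ → ℤ → ℝ by σ_{N+1} i j = ∑ k, P̃_N k * Real.sqrt (T k i * T k j). Then σ_{N+1} i j = 0 unless both i and j lie in S := Finset.Icc (a − V*(N+1)) (b + V*(N+1)); the finite matrix obtained by restricting σ_{N+1} to S × S is symmetric positive semidefinite with trace 1, and its von Neumann entropy is at most Real.log ((b − a + 1) + 2*V*(N+1)). -/
/-- The `N`-step distribution of the classical random walk on `ℤ`:
`P̃_0 = P` and `P̃_{N+1} j = ∑ i, P̃_N i * T i j`. -/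
noncomputable def Ptil (P : ℤ → ℝ) (T : ℤ → ℤ → ℝ) : ℕ → ℤ → ℝ
  | 0 => P
  | (N + 1) => fun j => ∑' i : ℤ, Ptil P T N i * T i j

section RandomWalk

variable {a b : ℤ} {V : ℕ} {P : ℤ → ℝ} {T : ℤ → ℤ → ℝ}

theorem Ptil_nonneg (hP0 : ∀ i, 0 ≤ P i) (hT0 : ∀ i j, 0 ≤ T i j) (N : ℕ) (j : ℤ) :
    0 ≤ Ptil P T N j := by
  induction N generalizing j with
  | zero => exact hP0 j
  | succ N ih => exact tsum_nonneg fun i => mul_nonneg (ih i) (hT0 i j)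

/-- A product of an `N`-step weight and a jump out of the `(N+1)`-step window vanishes. -/
theorem eq_zero_or_transition_eq_zero (hTrange : ∀ i j : ℤ, (V : ℤ) < |j - i| → T i j = 0)
    {p : ℤ → ℝ} {N : ℕ}
    (hp : ∀ k, k ∉ Finset.Icc (a - (V : ℤ) * N) (b + (V : ℤ) * N) → p k = 0)
    {j : ℤ} (hj : j ∉ Finset.Icc (a - (V : ℤ) * (N + 1)) (b + (V : ℤ) * (N + 1))) (k : ℤ) :
    p k = 0 ∨ T k j = 0 := by
  by_cases hk : k ∈ Finset.Icc (a - (V : ℤ) * N) (b + (V : ℤ) * N)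
  · right
    apply hTrange
    rw [Finset.mem_Icc] at hk hj
    rw [lt_abs]
    by_contra! h
    apply hj
    constructor <;> linarith [h.1, h.2]
  · exact Or.inl (hp k hk)

theorem Ptil_eq_zero (hPsupp : ∀ i, i ∉ Finset.Icc a b → P i = 0)
    (hTrange : ∀ i j : ℤ, (V : ℤ) < |j - i| → T i j = 0) (N : ℕ) (j : ℤ)
    (hj : j ∉ Finset.Icc (a - (V : ℤ) * N) (b + (V : ℤ) * N)) : Ptil P T N j = 0 := by
  induction N generalizing j with
  | zero => exact hPsupp j (by simpa using hj)
  | succ N ih =>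
    push_cast at hj
    have h : ∀ i, Ptil P T N i * T i j = 0 := fun i =>
      mul_eq_zero.mpr (eq_zero_or_transition_eq_zero hTrange ih hj i)
    simp [Ptil, h]

theorem sum_Ptil (hPsupp : ∀ i, i ∉ Finset.Icc a b → P i = 0) (hPsum : ∑' i : ℤ, P i = 1)
    (hTrow : ∀ i, ∑' j : ℤ, T i j = 1)
    (hTrange : ∀ i j : ℤ, (V : ℤ) < |j - i| → T i j = 0) (N : ℕ) :
    ∑ j ∈ Finset.Icc (a - (V : ℤ) * N) (b + (V : ℤ) * N), Ptil P T N j = 1 := by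
  induction N with
  | zero =>
    simp only [Nat.cast_zero, mul_zero, sub_zero, add_zero]
    rw [← hPsum, tsum_eq_sum hPsupp]
    rfl
  | succ N ih =>
    have hstep : ∀ j, Ptil P T (N + 1) j =
        ∑ k ∈ Finset.Icc (a - (V : ℤ) * N) (b + (V : ℤ) * N), Ptil P T N k * T k j := fun j =>
      tsum_eq_sum fun k hk => by rw [Ptil_eq_zero hPsupp hTrange N k hk, zero_mul]
    simp_rw [hstep]
    rw [Finset.sum_comm, ← ih]
    refine Finset.sum_congr rfl fun k hk => ?_
    rw [← Finset.mul_sum]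
    conv_rhs => rw [← mul_one (Ptil P T N k), ← hTrow k]
    congr 1
    refine (tsum_eq_sum fun j hj => hTrange k j ?_).symm
    rw [Finset.mem_Icc] at hk hj
    push_cast at hj
    rw [lt_abs]
    by_contra! h
    apply hj
    constructor <;> linarith [h.1, h.2]

end RandomWalk

/-- Jensen's inequality for the entropy: a distribution on a finite type has entropy at most the
logarithm of the cardinality. -/
theorem sum_negMulLog_le_log_card {ι : Type*} [Fintype ι] {p : ι → ℝ} (hp : ∀ i, 0 ≤ p i)
    (hsum : ∑ i, p i = 1) : ∑ i, Real.negMulLog (p i) ≤ Real.log (Fintype.card ι) := by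
  have : Nonempty ι := by
    by_contra h
    rw [not_nonempty_iff] at h
    simp at hsum
  have hn : (0 : ℝ) < Fintype.card ι := by exact_mod_cast Fintype.card_pos
  have h := Real.concaveOn_negMulLog.le_map_sum (t := Finset.univ)
    (w := fun _ : ι => (Fintype.card ι : ℝ)⁻¹) (p := p) (fun _ _ => by positivity)
    (by simp [hn.ne']) (fun i _ => hp i)
  simp only [smul_eq_mul, ← Finset.mul_sum, hsum, mul_one] at h
  rw [Real.negMulLog, Real.log_inv, neg_mul_neg] at h
  exact le_of_mul_le_mul_left h (inv_pos.mpr hn)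

theorem vnEntropy_le_log_card {n : Type*} [Fintype n] [DecidableEq n] {ρ : Matrix n n ℝ}
    (hρ : ρ.IsHermitian) (hpos : ρ.PosSemidef) (htr : ρ.trace = 1) :
    vnEntropy hρ ≤ Real.log (Fintype.card n) := by
  refine sum_negMulLog_le_log_card (fun i => hpos.eigenvalues_nonneg i) ?_
  have h := hρ.trace_eq_sum_eigenvalues
  rw [htr] at h
  simpa using h.symm

/-- infinite-dimensional entropy bound. The reduced density
`σ_{N+1} i j = ∑ k, P̃_N k * √(T k i * T k j)` is supported in
`S = Finset.Icc (a - V*(N+1)) (b + V*(N+1))`; its restriction to `S × S` is a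
symmetric positive semidefinite matrix of trace 1 whose von Neumann entropy is at
most `log ((b - a + 1) + 2*V*(N+1))`. -/
theorem sigma_entropy_bound (a b : ℤ) (hab : a ≤ b) (V : ℕ)
    (P : ℤ → ℝ) (hP0 : ∀ i, 0 ≤ P i) (hPsupp : ∀ i, i ∉ Finset.Icc a b → P i = 0)
    (hPsum : ∑' i : ℤ, P i = 1)
    (T : ℤ → ℤ → ℝ) (hT0 : ∀ i j, 0 ≤ T i j)
    (hTrow : ∀ i, ∑' j : ℤ, T i j = 1)
    (hTrange : ∀ i j : ℤ, (V : ℤ) < |j - i| → T i j = 0)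
    (N : ℕ)
    (σ : ℤ → ℤ → ℝ)
    (hσ : ∀ i j : ℤ, σ i j = ∑' k : ℤ, Ptil P T N k * Real.sqrt (T k i * T k j))
    (S : Finset ℤ) (hS : S = Finset.Icc (a - (V : ℤ) * (N + 1)) (b + (V : ℤ) * (N + 1)))
    (M : Matrix S S ℝ) (hM : ∀ i j : S, M i j = σ i.1 j.1) :
    (∀ i j : ℤ, i ∉ S ∨ j ∉ S → σ i j = 0) ∧
    M.IsHermitian ∧ M.PosSemidef ∧ M.trace = 1 ∧
    ∀ h : M.IsHermitian,
      vnEntropy h ≤ Real.log (((b - a + 1) + 2 * (V : ℤ) * (N + 1) : ℤ) : ℝ) := by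
  have hsupp : ∀ k, k ∉ Finset.Icc (a - (V : ℤ) * N) (b + (V : ℤ) * N) → Ptil P T N k = 0 :=
    Ptil_eq_zero hPsupp hTrange N
  have hpos : M.PosSemidef := by
    have hM' : M = ∑ k ∈ Finset.Icc (a - (V : ℤ) * N) (b + (V : ℤ) * N), Ptil P T N k •
        Matrix.vecMulVec (fun i : S => √(T k i)) (star fun i : S => √(T k i)) := by
      ext i j
      rw [hM, hσ, tsum_eq_sum fun k hk => by rw [hsupp k hk, zero_mul], Matrix.sum_apply]
      simp [Matrix.vecMulVec_apply, Real.sqrt_mul (hT0 _ _)]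
    rw [hM']
    exact Matrix.posSemidef_sum _ fun k _ =>
      (Matrix.posSemidef_vecMulVec_self_star _).smul (Ptil_nonneg hP0 hT0 N k)
  have htr : M.trace = 1 := by
    have hdiag : ∀ i, σ i i = Ptil P T (N + 1) i := fun i => by
      rw [hσ]
      simp only [Real.sqrt_mul_self (hT0 _ _), Ptil]
    have h := sum_Ptil hPsupp hPsum hTrow hTrange (N + 1)
    push_cast at h
    rw [← hS, ← Finset.sum_coe_sort] at h
    simpa [Matrix.trace, hM, hdiag] using h
  refine ⟨fun i j hij => ?_, hpos.isHermitian, hpos, htr, fun h => ?_⟩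
  · have hz : ∀ k, Ptil P T N k * √(T k i * T k j) = 0 := fun k => by
      rw [hS] at hij
      rcases hij with hi | hj
      · rcases eq_zero_or_transition_eq_zero hTrange hsupp hi k with h | h <;> simp [h]
      · rcases eq_zero_or_transition_eq_zero hTrange hsupp hj k with h | h <;> simp [h]
    simp [hσ, hz]
  · refine (vnEntropy_le_log_card h hpos htr).trans_eq ?_
    have hcard : ((Fintype.card S : ℕ) : ℤ) = (b - a + 1) + 2 * (V : ℤ) * (N + 1) := by
      have hV : 0 ≤ (V : ℤ) * (N + 1) := by positivity
      rw [Fintype.card_coe, hS, Int.card_Icc, Int.toNat_of_nonneg (by linarith)]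
      ring
    rw [← hcard, Int.cast_natCast]
end
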